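/- There exists a constant C > 0 such that for every Schwartz function u : ℝ⁴ → ℝ satisfying the axial symmetry condition u(x₁,x₂,x₃,x₄) = ũ(√(x₁²+x₂²+x₃²), x₄) for some ũ : ℝ₊ × ℝ → ℝ, one has (∫_{ℝ⁴} |x'|·|u(x)|⁵ dx)^{1/5} ≤ C‖∇u‖_{L²(ℝ⁴)}, where x' = (x₁,x₂,x₃). -/

import Mathlib

open Real MeasureTheory
open Filter Topology Set Module
open scoped ENNReal NNReal

lemma eLpNorm_le_eLpNorm_fderiv_of_memLp {E : Type*} [NormedAddCommGroup E] [NormedSpace ℝ E]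
    [FiniteDimensional ℝ E] [MeasurableSpace E] [BorelSpace E] (μ : Measure E) [μ.IsAddHaarMeasure]
    {u : E → ℝ} (hu : ContDiff ℝ 1 u) {p p' : ℝ≥0} (hp : 1 ≤ p) (hn : 0 < finrank ℝ E)
    (hp' : (p' : ℝ)⁻¹ = (p : ℝ)⁻¹ - (finrank ℝ E : ℝ)⁻¹) (h2u : MemLp u p μ) :
    eLpNorm u p' μ ≤ eLpNormLESNormFDerivOfEqInnerConst μ p * eLpNorm (fderiv ℝ u) p μ := by
  let χ : ContDiffBump (0 : E) := ⟨1, 2, one_pos, one_lt_two⟩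
  have hχ : ContDiff ℝ 1 χ := χ.contDiff
  obtain ⟨M, hM⟩ : ∃ M, ∀ x, ‖fderiv ℝ χ x‖ ≤ M :=
    (hχ.continuous_fderiv one_ne_zero).bounded_above_of_compact_support
      (χ.hasCompactSupport.fderiv ℝ)
  have hM0 : 0 ≤ M := (norm_nonneg _).trans (hM 0)
  let c : ℕ → ℝ := fun n ↦ 1 / ((n : ℝ) + 1)
  have hc0 : ∀ n, 0 < c n := fun n ↦ Nat.one_div_pos_of_nat
  have hc : Tendsto c atTop (𝓝 0) := tendsto_one_div_add_atTop_nhds_zero_nat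
  let w : ℕ → E → ℝ := fun n x ↦ χ (c n • x) * u x
  have hcχ : ∀ n, ContDiff ℝ 1 fun x ↦ χ (c n • x) := fun n ↦ hχ.comp (contDiff_const_smul (c n))
  have hw : ∀ n, ContDiff ℝ 1 (w n) := fun n ↦ (hcχ n).mul hu
  have hws : ∀ n, HasCompactSupport (w n) := fun n ↦
    (χ.hasCompactSupport.comp_smul (hc0 n).ne').mul_right
  have hbound : ∀ n x, ‖fderiv ℝ (w n) x‖ ≤ ‖fderiv ℝ u x‖ + c n * M * ‖u x‖ := by
    intro n x
    have h1 : fderiv ℝ (w n) x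
        = χ (c n • x) • fderiv ℝ u x + u x • fderiv ℝ (fun x ↦ χ (c n • x)) x :=
      fderiv_fun_mul ((hcχ n).differentiable one_ne_zero x) (hu.differentiable one_ne_zero x)
    have h2 : fderiv ℝ (fun x ↦ χ (c n • x)) x = c n • fderiv ℝ χ (c n • x) := by
      exact fderiv_comp_smul (f := χ) (c n)
    rw [h1, h2]
    refine (norm_add_le _ _).trans (add_le_add ?_ ?_)
    · rw [norm_smul, Real.norm_of_nonneg χ.nonneg]
      exact mul_le_of_le_one_left (norm_nonneg _) χ.le_one
    · rw [norm_smul, norm_smul, Real.norm_of_nonneg (hc0 n).le, mul_comm]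
      gcongr
      exact hM _
  have hmeas : AEStronglyMeasurable (fun x ↦ ‖fderiv ℝ u x‖) μ :=
    (hu.continuous_fderiv one_ne_zero).norm.aestronglyMeasurable
  have hgrad : ∀ n, eLpNorm (fderiv ℝ (w n)) p μ
      ≤ eLpNorm (fderiv ℝ u) p μ + ENNReal.ofReal (c n * M) * eLpNorm u p μ := by
    intro n
    have hcM : 0 ≤ c n * M := mul_nonneg (hc0 n).le hM0
    calc eLpNorm (fderiv ℝ (w n)) p μ
        ≤ eLpNorm (fun x ↦ ‖fderiv ℝ u x‖ + (c n * M) * ‖u x‖) p μ :=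
          eLpNorm_mono_real (hbound n)
      _ ≤ eLpNorm (fun x ↦ ‖fderiv ℝ u x‖) p μ + eLpNorm (fun x ↦ (c n * M) * ‖u x‖) p μ :=
          eLpNorm_add_le hmeas (h2u.1.norm.const_mul _) (by exact_mod_cast hp)
      _ = _ := by
          have := eLpNorm_const_smul (c n * M) (fun x ↦ ‖u x‖) (p : ℝ≥0∞) μ
          rw [eLpNorm_norm, Real.enorm_of_nonneg hcM] at this
          rw [eLpNorm_norm]
          exact congrArg _ this
  have hlim : Tendsto (fun n ↦ (eLpNormLESNormFDerivOfEqInnerConst μ p : ℝ≥0∞) *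
      (eLpNorm (fderiv ℝ u) p μ + ENNReal.ofReal (c n * M) * eLpNorm u p μ)) atTop
      (𝓝 (eLpNormLESNormFDerivOfEqInnerConst μ p * eLpNorm (fderiv ℝ u) p μ)) := by
    refine ENNReal.Tendsto.const_mul ?_ (Or.inr ENNReal.coe_ne_top)
    have h1 : Tendsto (fun n ↦ ENNReal.ofReal (c n * M)) atTop (𝓝 0) := by
      simpa using ENNReal.tendsto_ofReal (hc.mul_const M)
    simpa using tendsto_const_nhds.add
      (ENNReal.Tendsto.mul_const h1 (Or.inr h2u.eLpNorm_ne_top))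
  have hpt : ∀ x, Tendsto (fun n ↦ w n x) atTop (𝓝 (u x)) := by
    intro x
    have h1 : Tendsto (fun n ↦ c n • x) atTop (𝓝 0) := by simpa using hc.smul_const x
    have h2 : Tendsto (fun n ↦ χ (c n • x)) atTop (𝓝 1) := by
      have := (χ.continuous.tendsto 0).comp h1
      rwa [χ.one_of_mem_closedBall (by simp [χ])] at this
    simpa using h2.mul_const (u x)
  refine (Lp.eLpNorm_lim_le_liminf_eLpNorm
    (fun n ↦ (hw n).continuous.aestronglyMeasurable) u (ae_of_all _ hpt)).trans ?_
  rw [← hlim.liminf_eq]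
  refine liminf_le_liminf (Eventually.of_forall fun n ↦ ?_)
  refine (eLpNorm_le_eLpNorm_fderiv_of_eq_inner μ (hw n) (hws n) hp hn hp').trans ?_
  gcongr
  exact hgrad n

lemma enorm_le_lintegral_deriv_of_tendsto_atBot {F : Type*} [NormedAddCommGroup F]
    [NormedSpace ℝ F] {f : ℝ → F} (hf : ContDiff ℝ 1 f)
    (h0 : Tendsto f atBot (𝓝 0)) (t : ℝ) : ‖f t‖ₑ ≤ ∫⁻ s, ‖deriv f s‖ₑ := by
  have hlim : Tendsto (fun s ↦ ‖f t - f s‖ₑ) atBot (𝓝 ‖f t‖ₑ) := by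
    simpa using (tendsto_const_nhds.sub h0 : Tendsto (fun s ↦ f t - f s) atBot _).enorm
  refine le_of_tendsto hlim ?_
  filter_upwards [eventually_le_atBot t] with s hs
  exact (enorm_sub_le_lintegral_deriv_of_contDiffOn_Icc hf.contDiffOn hs).trans
    (setLIntegral_le_lintegral _ _)

/-- `r f(r)² - R f(R)²` is controlled by `∫ s² f'(s)²`. -/
lemma mul_sq_le_add_integral_sq_mul_deriv_sq {f : ℝ → ℝ} (hf : ContDiff ℝ 1 f) {r R : ℝ}
    (hrR : r ≤ R) :
    r * f r ^ 2 ≤ R * f R ^ 2 + ∫ s in r..R, s ^ 2 * deriv f s ^ 2 := by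
  have hd := hf.continuous_deriv le_rfl
  have hc := hf.continuous
  have h1 : ∀ s, HasDerivAt (fun s ↦ s * f s ^ 2)
      (f s ^ 2 + 2 * s * f s * deriv f s) s := by
    intro s
    refine ((hasDerivAt_id' s).fun_mul
      (((hf.differentiable one_ne_zero s).hasDerivAt).fun_pow 2)).congr_deriv ?_
    push_cast
    ring
  have h2 : ∫ s in r..R, (f s ^ 2 + 2 * s * f s * deriv f s) = R * f R ^ 2 - r * f r ^ 2 :=
    intervalIntegral.integral_eq_sub_of_hasDerivAt (fun s _ ↦ h1 s)
      (Continuous.intervalIntegrable (by fun_prop) _ _)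
  have h3 : ∫ s in r..R, -(s ^ 2 * deriv f s ^ 2)
      ≤ ∫ s in r..R, (f s ^ 2 + 2 * s * f s * deriv f s) := by
    refine intervalIntegral.integral_mono_on hrR
      (Continuous.intervalIntegrable (by fun_prop) _ _)
      (Continuous.intervalIntegrable (by fun_prop) _ _) fun s _ ↦ ?_
    nlinarith [sq_nonneg (f s + s * deriv f s)]
  rw [intervalIntegral.integral_neg, h2] at h3
  linarith

/-- Three-dimensional radial Sobolev embedding. -/
lemma enorm_norm_mul_sq_mul_le_lintegral_fderiv {E : Type*} [NormedAddCommGroup E]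
    [NormedSpace ℝ E] [MeasurableSpace E] [BorelSpace E] (μ : Measure E)
    [FiniteDimensional ℝ E] [μ.IsAddHaarMeasure] (hdim : finrank ℝ E = 3) {f : E → ℝ}
    (hf : ContDiff ℝ 1 f) {v : ℝ → ℝ} (hv : ∀ x, f x = v ‖x‖)
    (h0 : Tendsto (fun x ↦ ‖x‖ * f x ^ 2) (cocompact E) (𝓝 0)) (x : E) :
    ENNReal.ofReal (3 * μ.real (Metric.ball 0 1)) * ‖‖x‖ * f x ^ 2‖ₑ
      ≤ ∫⁻ y, ‖fderiv ℝ f y‖ₑ ^ 2 ∂μ := by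
  rcases eq_or_ne x 0 with rfl | hx
  · simp
  have : Nontrivial E := ⟨x, 0, hx⟩
  have hxn : 0 < ‖x‖ := norm_pos_iff.2 hx
  set e : E := ‖x‖⁻¹ • x with he
  have hen : ‖e‖ = 1 := norm_smul_inv_norm (𝕜 := ℝ) hx
  set r := ‖x‖
  let φ : ℝ → ℝ := fun s ↦ f (s • e)
  have hφ : ContDiff ℝ 1 φ := hf.comp (contDiff_id.smul contDiff_const)
  have hφv : ∀ s, 0 ≤ s → φ s = v s := fun s hs ↦ by
    simp [φ, hv, norm_smul, hen, abs_of_nonneg hs]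
  have hderiv : ∀ y : E, y ≠ 0 → ‖deriv φ ‖y‖‖ ≤ ‖fderiv ℝ f y‖ := by
    intro y hy
    have hyn : 0 < ‖y‖ := norm_pos_iff.2 hy
    set a : E := ‖y‖⁻¹ • y with ha
    have han : ‖a‖ = 1 := norm_smul_inv_norm (𝕜 := ℝ) hy
    have hya : ‖y‖ • a = y := by rw [ha, smul_smul, mul_inv_cancel₀ hyn.ne', one_smul]
    have h1 : φ =ᶠ[𝓝 ‖y‖] fun s ↦ f (s • a) := by
      filter_upwards [eventually_gt_nhds hyn] with s hs
      rw [hφv s hs.le, hv, norm_smul, han, mul_one, Real.norm_of_nonneg hs.le]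
    have h2 : HasDerivAt (fun s : ℝ ↦ f (s • a)) (fderiv ℝ f y a) ‖y‖ := by
      have hfd : HasFDerivAt f (fderiv ℝ f y) (‖y‖ • a) := by
        rw [hya]; exact (hf.differentiable one_ne_zero y).hasFDerivAt
      have := hfd.comp_hasDerivAt ‖y‖ ((hasDerivAt_id' ‖y‖).smul_const a)
      rwa [one_smul] at this
    rw [h1.deriv_eq, h2.deriv]
    simpa [han] using (fderiv ℝ f y).le_opNorm a
  have hle : ∀ R, r ≤ R → ENNReal.ofReal (3 * μ.real (Metric.ball 0 1)
      * (r * f x ^ 2 - R * f (R • e) ^ 2)) ≤ ∫⁻ y, ‖fderiv ℝ f y‖ₑ ^ 2 ∂μ := by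
    intro R hR
    let g : ℝ → ℝ := (Ioc r R).indicator fun s ↦ deriv φ s ^ 2
    have h1 := integral_fun_norm_addHaar μ g
    have h2 : ∫ s in Ioi (0 : ℝ), s ^ (finrank ℝ E - 1) • g s
        = ∫ s in r..R, s ^ 2 * deriv φ s ^ 2 := by
      rw [intervalIntegral.integral_of_le hR, hdim]
      have : ∀ s, s ^ (3 - 1) • g s = (Ioc r R).indicator (fun s ↦ s ^ 2 * deriv φ s ^ 2) s := by
        intro s
        by_cases hs : s ∈ Ioc r R <;> simp [g, hs]
      simp_rw [this]
      rw [setIntegral_indicator measurableSet_Ioc]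
      congr 2
      exact inter_eq_right.2 fun s hs ↦ hxn.trans hs.1
    rw [h2, hdim, nsmul_eq_mul, smul_eq_mul] at h1
    have h3 := mul_sq_le_add_integral_sq_mul_deriv_sq hφ hR
    have h4 : φ r = f x := by
      simp only [φ, he]; rw [smul_smul, mul_inv_cancel₀ hxn.ne', one_smul]
    rw [h4] at h3
    calc _ ≤ ENNReal.ofReal (∫ y, g ‖y‖ ∂μ) := by
          rw [h1, mul_assoc]
          push_cast
          gcongr
          simp only [φ] at h3 ⊢
          linarith
      _ ≤ ‖∫ y, g ‖y‖ ∂μ‖ₑ := Real.ofReal_le_enorm _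
      _ ≤ ∫⁻ y, ‖g ‖y‖‖ₑ ∂μ := enorm_integral_le_lintegral_enorm _
      _ ≤ _ := by
          refine lintegral_mono fun y ↦ ?_
          by_cases hy : ‖y‖ ∈ Ioc r R
          · simp only [g, indicator_of_mem hy, enorm_pow]
            gcongr
            exact enorm_le_iff_norm_le.2 (hderiv y (norm_pos_iff.1 (hxn.trans hy.1)))
          · simp [g, hy]
  have hlim : Tendsto (fun R : ℝ ↦ R * f (R • e) ^ 2) atTop (𝓝 0) := by
    have h1 : Tendsto (fun R : ℝ ↦ R • e) atTop (cocompact E) := by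
      rw [← Metric.cobounded_eq_cocompact, ← tendsto_norm_atTop_iff_cobounded]
      simpa [norm_smul, hen] using tendsto_abs_atTop_atTop
    refine (h0.comp h1).congr' ?_
    filter_upwards [eventually_ge_atTop 0] with R hR
    simp [norm_smul, hen, abs_of_nonneg hR]
  have hlim2 : Tendsto (fun R : ℝ ↦ ENNReal.ofReal (3 * μ.real (Metric.ball 0 1)
      * (r * f x ^ 2 - R * f (R • e) ^ 2))) atTop
      (𝓝 (ENNReal.ofReal (3 * μ.real (Metric.ball 0 1) * (r * f x ^ 2)))) := by
    refine ENNReal.tendsto_ofReal (Tendsto.const_mul _ ?_)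
    simpa using hlim.const_sub (r * f x ^ 2)
  rw [Real.enorm_of_nonneg (by positivity), ← ENNReal.ofReal_mul (by positivity)]
  refine le_of_tendsto hlim2 ?_
  filter_upwards [eventually_ge_atTop r] with R hR using hle R hR

section Axial

local notation "X" => EuclideanSpace ℝ (Fin 3)

instance isAddHaarMeasure_volume_prod_real : (volume : Measure (X × ℝ)).IsAddHaarMeasure :=
  Measure.prod.instIsAddHaarMeasure _ _

lemma norm_fderiv_slice_left_le {u : X × ℝ → ℝ} (hu : ContDiff ℝ 1 u) (x : X) (t : ℝ) :
    ‖fderiv ℝ (fun y ↦ u (y, t)) x‖ ≤ ‖fderiv ℝ u (x, t)‖ := by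
  have h : HasFDerivAt (fun y ↦ u (y, t))
      ((fderiv ℝ u (x, t)).comp (ContinuousLinearMap.inl ℝ X ℝ)) x :=
    (hu.differentiable one_ne_zero (x, t)).hasFDerivAt.comp x (hasFDerivAt_prodMk_left x t)
  rw [h.fderiv]
  exact (ContinuousLinearMap.opNorm_comp_le _ _).trans
    (mul_le_of_le_one_right (norm_nonneg _) (ContinuousLinearMap.norm_inl_le_one ℝ X ℝ))

lemma norm_deriv_slice_right_le {u : X × ℝ → ℝ} (hu : ContDiff ℝ 1 u) (x : X) (t : ℝ) :
    ‖deriv (fun s ↦ u (x, s)) t‖ ≤ ‖fderiv ℝ u (x, t)‖ := by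
  have h : HasFDerivAt (fun s ↦ u (x, s))
      ((fderiv ℝ u (x, t)).comp (ContinuousLinearMap.inr ℝ X ℝ)) t :=
    (hu.differentiable one_ne_zero (x, t)).hasFDerivAt.comp t (hasFDerivAt_prodMk_right x t)
  rw [norm_deriv_eq_norm_fderiv, h.fderiv]
  exact (ContinuousLinearMap.opNorm_comp_le _ _).trans
    (mul_le_of_le_one_right (norm_nonneg _) (ContinuousLinearMap.norm_inr_le_one ℝ X ℝ))

/-- Slices of a Schwartz function obey the radial Sobolev bound, uniformly in the slice. -/
lemma SchwartzMap.enorm_norm_mul_sq_mul_le_lintegral_fderiv (u : SchwartzMap (X × ℝ) ℝ)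
    {v : ℝ → ℝ → ℝ} (hv : ∀ x t, u (x, t) = v ‖x‖ t) (x : X) (t : ℝ) :
    ENNReal.ofReal (3 * volume.real (Metric.ball (0 : X) 1)) * ‖‖x‖ * u (x, t) ^ 2‖ₑ
      ≤ ∫⁻ y : X, ‖fderiv ℝ u (y, t)‖ₑ ^ 2 := by
  have hu : ContDiff ℝ 1 u := u.smooth 1
  have hiso : Isometry fun y : X ↦ (y, t) := Isometry.of_dist_eq fun a b ↦ by simp [Prod.dist_eq]
  have hlim : Tendsto (fun y : X ↦ u (y, t)) (cocompact X) (𝓝 0) :=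
    u.tendsto_cocompact.comp hiso.isClosedEmbedding.tendsto_cocompact
  obtain ⟨C, hC0, hC⟩ := u.decay 1 0
  have h0 : Tendsto (fun y : X ↦ ‖y‖ * u (y, t) ^ 2) (cocompact X) (𝓝 0) := by
    have h1 : Tendsto (fun y : X ↦ C * ‖u (y, t)‖) (cocompact X) (𝓝 0) := by
      simpa using hlim.norm.const_mul C
    refine squeeze_zero (fun y ↦ by positivity) (fun y ↦ ?_) h1
    have h2 := hC (y, t)
    rw [pow_one, norm_iteratedFDeriv_zero] at h2
    have h3 : ‖y‖ ≤ ‖(y, t)‖ := norm_fst_le (y, t)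
    calc ‖y‖ * u (y, t) ^ 2 = ‖y‖ * ‖u (y, t)‖ * ‖u (y, t)‖ := by
          rw [mul_assoc, ← sq, Real.norm_eq_abs, sq_abs]
      _ ≤ ‖(y, t)‖ * ‖u (y, t)‖ * ‖u (y, t)‖ := by gcongr
      _ ≤ _ := by gcongr
  refine (_root_.enorm_norm_mul_sq_mul_le_lintegral_fderiv volume finrank_euclideanSpace_fin
    (f := fun y ↦ u (y, t)) (hu.comp (by fun_prop)) (v := fun s ↦ v s t) (fun y ↦ hv y t)
    h0 x).trans (lintegral_mono fun y ↦ ?_)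
  gcongr
  exact enorm_le_iff_norm_le.2 (norm_fderiv_slice_left_le hu y t)

/-- Uniform bound on the `L³` norms of slices of a Schwartz function. -/
lemma SchwartzMap.lintegral_slice_enorm_pow_three_le (u : SchwartzMap (X × ℝ) ℝ) (t : ℝ) :
    ∫⁻ x : X, ‖u (x, t)‖ₑ ^ 3 ≤ 3 * ∫⁻ p : X × ℝ, ‖u p‖ₑ ^ 2 * ‖fderiv ℝ u p‖ₑ := by
  have hu : ContDiff ℝ 1 u := u.smooth 1
  have hc : Continuous (fderiv ℝ u) := hu.continuous_fderiv one_ne_zero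
  have hcu : Continuous u := u.continuous
  rw [Measure.volume_eq_prod, lintegral_prod _ (by fun_prop), ← lintegral_const_mul' _ _ (by simp)]
  refine lintegral_mono fun x ↦ ?_
  have hiso : Isometry fun s : ℝ ↦ (x, s) := Isometry.of_dist_eq fun a b ↦ by simp [Prod.dist_eq]
  have hlim : Tendsto (fun s : ℝ ↦ u (x, s)) atBot (𝓝 0) :=
    (u.tendsto_cocompact.comp hiso.isClosedEmbedding.tendsto_cocompact).mono_left atBot_le_cocompact
  have hs : ContDiff ℝ 1 fun s : ℝ ↦ u (x, s) := hu.comp (by fun_prop)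
  have h := enorm_le_lintegral_deriv_of_tendsto_atBot (hs.pow 3) (by simpa using hlim.pow 3) t
  rw [← lintegral_const_mul' _ _ (by simp), ← enorm_pow]
  refine h.trans (lintegral_mono fun s ↦ ?_)
  have hd := ((hs.differentiable one_ne_zero s).hasDerivAt.fun_pow 3).deriv
  have h3 : ‖(3 : ℝ)‖ₑ = 3 := by simp [Real.enorm_eq_ofReal_abs]
  rw [hd, enorm_mul, enorm_mul, enorm_pow, mul_assoc]
  push_cast
  rw [h3]
  gcongr
  exact enorm_le_iff_norm_le.2 (norm_deriv_slice_right_le hu x s)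

lemma SchwartzMap.lintegral_norm_mul_enorm_pow_five_le (u : SchwartzMap (X × ℝ) ℝ)
    {v : ℝ → ℝ → ℝ} (hv : ∀ x t, u (x, t) = v ‖x‖ t) :
    ENNReal.ofReal (3 * volume.real (Metric.ball (0 : X) 1)) *
        ∫⁻ p : X × ℝ, ‖‖p.1‖ * |u p| ^ 5‖ₑ
      ≤ 3 * (eLpNormLESNormFDerivOfEqInnerConst (volume : Measure (X × ℝ)) 2 : ℝ≥0∞) ^ 2 *
        eLpNorm (fderiv ℝ u) 2 volume ^ 5 := by
  have hu : ContDiff ℝ 1 u := u.smooth 1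
  have hc : Continuous (fderiv ℝ u) := hu.continuous_fderiv one_ne_zero
  have hcu : Continuous u := u.continuous
  set S : ℝ≥0∞ := (eLpNormLESNormFDerivOfEqInnerConst (volume : Measure (X × ℝ)) 2 : ℝ≥0∞)
  set A := eLpNorm (fderiv ℝ u) 2 volume
  have hA2 : ∫⁻ p : X × ℝ, ‖fderiv ℝ u p‖ₑ ^ 2 = A ^ 2 := by
    have := eLpNorm_nnreal_pow_eq_lintegral (f := fderiv ℝ u) (p := 2) (μ := volume) two_ne_zero
    simpa using this.symm
  have hL4 : (∫⁻ p : X × ℝ, (‖u p‖ₑ ^ 2) ^ (2 : ℝ)) ^ (1 / (2 : ℝ)) ≤ (S * A) ^ 2 := by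
    have h1 := eLpNorm_nnreal_pow_eq_lintegral (f := u) (p := 4) (μ := volume) four_ne_zero
    have h2 : eLpNorm u (4 : ℝ≥0) volume ≤ S * A :=
      eLpNorm_le_eLpNorm_fderiv_of_memLp volume hu one_le_two (by simp) (by norm_num)
        (u.memLp _ volume)
    have h3 : ∀ p, (‖u p‖ₑ ^ 2) ^ (2 : ℝ) = ‖u p‖ₑ ^ ((4 : ℝ≥0) : ℝ) := fun p ↦ by
      rw [← ENNReal.rpow_natCast, ← ENNReal.rpow_mul]; norm_num
    simp_rw [h3]
    rw [← h1, ← ENNReal.rpow_mul, ← ENNReal.rpow_natCast (S * A)]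
    norm_num
    gcongr
    simpa using h2
  have hL3 : ∫⁻ p : X × ℝ, ‖u p‖ₑ ^ 2 * ‖fderiv ℝ u p‖ₑ ≤ S ^ 2 * A ^ 3 := by
    have h1 := ENNReal.lintegral_mul_le_Lp_mul_Lq (volume : Measure (X × ℝ))
      Real.HolderConjugate.two_two (f := fun p ↦ ‖u p‖ₑ ^ 2) (g := fun p ↦ ‖fderiv ℝ u p‖ₑ)
      (by fun_prop) (by fun_prop)
    refine h1.trans ?_
    have h2 : (∫⁻ p : X × ℝ, ‖fderiv ℝ u p‖ₑ ^ (2 : ℝ)) ^ (1 / (2 : ℝ)) = A := by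
      simp_rw [ENNReal.rpow_two, hA2]
      rw [← ENNReal.rpow_two, ← ENNReal.rpow_mul]; norm_num
    rw [h2]
    calc _ ≤ (S * A) ^ 2 * A := by gcongr
      _ = _ := by ring
  rw [← lintegral_const_mul' _ _ ENNReal.ofReal_ne_top, Measure.volume_eq_prod,
    lintegral_prod_symm' _ (by fun_prop)]
  calc _ ≤ ∫⁻ t : ℝ, ∫⁻ x : X, (∫⁻ y : X, ‖fderiv ℝ u (y, t)‖ₑ ^ 2) * ‖u (x, t)‖ₑ ^ 3 := by
        refine lintegral_mono fun t ↦ lintegral_mono fun x ↦ ?_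
        have h : ‖x‖ * |u (x, t)| ^ 5 = ‖x‖ * u (x, t) ^ 2 * |u (x, t)| ^ 3 := by
          rw [← sq_abs]; ring
        simp only [h]
        rw [enorm_mul _ (|u (x, t)| ^ 3), enorm_pow, Real.enorm_abs, ← mul_assoc]
        gcongr
        exact u.enorm_norm_mul_sq_mul_le_lintegral_fderiv hv x t
    _ ≤ ∫⁻ t : ℝ, (∫⁻ y : X, ‖fderiv ℝ u (y, t)‖ₑ ^ 2) * (3 * (S ^ 2 * A ^ 3)) := by
        refine lintegral_mono fun t ↦ ?_
        simp only
        have hm : Continuous fun x : X ↦ u (x, t) := hcu.comp (by fun_prop)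
        rw [lintegral_const_mul _ (hm.measurable.enorm.pow_const 3)]
        gcongr
        exact (u.lintegral_slice_enorm_pow_three_le t).trans (by gcongr)
    _ = A ^ 2 * (3 * (S ^ 2 * A ^ 3)) := by
        rw [lintegral_mul_const, ← lintegral_prod_symm' (fun p : X × ℝ ↦ ‖fderiv ℝ u p‖ₑ ^ 2)
          (by fun_prop), ← Measure.volume_eq_prod, hA2]
        exact Measurable.lintegral_prod_left' (f := fun p : X × ℝ ↦ ‖fderiv ℝ u p‖ₑ ^ 2)
          (by fun_prop)
    _ = _ := by ring

end Axial

/-- Weighted L⁵ bound for axially symmetric Schwartz functions on ℝ⁴,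
modeled as ℝ³ × ℝ (with ℝ³ the Euclidean space in the symmetric variables). -/
theorem weighted_L5_axial :
    ∃ C > 0, ∀ u : SchwartzMap (EuclideanSpace ℝ (Fin 3) × ℝ) ℝ,
      (∃ v : ℝ → ℝ → ℝ, ∀ (x' : EuclideanSpace ℝ (Fin 3)) (t : ℝ), u (x', t) = v ‖x'‖ t) →
      (∫ x : EuclideanSpace ℝ (Fin 3) × ℝ, ‖x.1‖ * |u x| ^ 5) ^ ((1:ℝ)/5) ≤
        C * (∫ x : EuclideanSpace ℝ (Fin 3) × ℝ, ‖fderiv ℝ u x‖ ^ 2) ^ ((1:ℝ)/2) := by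
  set k : ℝ := 3 * volume.real (Metric.ball (0 : EuclideanSpace ℝ (Fin 3)) 1)
  set S : ℝ≥0 :=
    eLpNormLESNormFDerivOfEqInnerConst (volume : Measure (EuclideanSpace ℝ (Fin 3) × ℝ)) 2
  have hk0 : 0 < k := mul_pos three_pos
    (ENNReal.toReal_pos (Metric.measure_ball_pos _ _ one_pos).ne' measure_ball_lt_top.ne)
  refine ⟨(3 * (S : ℝ) ^ 2 / k) ^ ((1 : ℝ) / 5) + 1, by positivity, ?_⟩
  rintro u ⟨v, hv⟩
  have hu : ContDiff ℝ 1 u := u.smooth 1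
  have hc : Continuous (fderiv ℝ u) := hu.continuous_fderiv one_ne_zero
  have hcu : Continuous u := u.continuous
  have hmem : MemLp (fderiv ℝ u) 2 volume :=
    (SchwartzMap.fderivCLM ℝ _ ℝ u).memLp 2 volume
  have hA : (eLpNorm (fderiv ℝ u) 2 volume).toReal
      = (∫ x : EuclideanSpace ℝ (Fin 3) × ℝ, ‖fderiv ℝ u x‖ ^ 2) ^ ((1:ℝ)/2) := by
    rw [hmem.eLpNorm_eq_integral_rpow_norm two_ne_zero ENNReal.ofNat_ne_top,
      ENNReal.toReal_ofReal (by positivity)]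
    simp
  rw [← hA]
  set a := (eLpNorm (fderiv ℝ u) 2 volume).toReal
  have ha : 0 ≤ a := ENNReal.toReal_nonneg
  have hJ : k * ∫ x : EuclideanSpace ℝ (Fin 3) × ℝ, ‖x.1‖ * |u x| ^ 5
      ≤ 3 * (S : ℝ) ^ 2 * a ^ 5 := by
    have h1 := ENNReal.toReal_mono
      (ENNReal.mul_ne_top (by finiteness) (ENNReal.pow_ne_top hmem.eLpNorm_ne_top))
      (u.lintegral_norm_mul_enorm_pow_five_le hv)
    rw [ENNReal.toReal_mul, ENNReal.toReal_ofReal hk0.le,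
      ← integral_norm_eq_lintegral_enorm (by fun_prop)] at h1
    have h2 : ∀ x : EuclideanSpace ℝ (Fin 3) × ℝ, ‖‖x.1‖ * |u x| ^ 5‖ = ‖x.1‖ * |u x| ^ 5 :=
      fun x ↦ Real.norm_of_nonneg (by positivity)
    simpa [h2] using h1
  have hJ0 : 0 ≤ ∫ x : EuclideanSpace ℝ (Fin 3) × ℝ, ‖x.1‖ * |u x| ^ 5 :=
    integral_nonneg fun x ↦ by positivity
  calc _ ≤ (3 * (S : ℝ) ^ 2 / k * a ^ 5) ^ ((1 : ℝ) / 5) := by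
        gcongr
        rw [div_mul_eq_mul_div, le_div_iff₀ hk0, mul_comm]
        exact hJ
    _ = (3 * (S : ℝ) ^ 2 / k) ^ ((1 : ℝ) / 5) * a := by
        rw [Real.mul_rpow (by positivity) (by positivity), ← Real.rpow_natCast a, ← Real.rpow_mul ha]
        norm_num
    _ ≤ _ := by gcongr; linarith
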